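/- Suppose the Borel probability measure α on Ω is C*-Gibbs for a Hölder potential U, i.e., the Gibbs identity holds for all symmetric (n = m) conjugating homeomorphisms. Then the same identity holds for every (possibly non-symmetric) conjugating homeomorphism: for all integers n, m ≥ 1, every conjugating homeomorphism (O, φ) with window −n ≤ j ≤ m, and every continuous f : Ω → ℂ, ∫_O e^{−V(z, φ(z))} f(φ(z)) dα(z) = ∫_{φ(O)} f dα. -/

import Mathlib

open MeasureTheory Filter
open scoped ENNReal

noncomputable section

/-- The two-sided full shift space `Ω = {1,…,d}^ℤ` (alphabet `Fin d`). -/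
abbrev Omega (d : ℕ) : Type := ℤ → Fin d

/-- The shift map `τ`, `(τ x) j = x (j+1)`. -/
def tau (d : ℕ) (x : Omega d) : Omega d := fun j => x (j + 1)

/-- The `k`-th iterate of the shift (`k ∈ ℤ`): `(τ^k x) j = x (j + k)`. -/
def tauZ (d : ℕ) (k : ℤ) (x : Omega d) : Omega d := fun j => x (j + k)

/-- `x` and `y` are homoclinic: they differ in only finitely many coordinates. -/
def Homoclinic (d : ℕ) (x y : Omega d) : Prop := Set.Finite {j : ℤ | x j ≠ y j}

/-- `U` is Hölder continuous for the standard metric `dist x y = 2^{-N}`: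
there are `C > 0` and `0 < θ < 1` with `|U x - U y| ≤ C θ^N` whenever
`x` and `y` agree on all coordinates `|j| ≤ N`. -/
def HolderPotential (d : ℕ) (U : Omega d → ℝ) : Prop :=
  ∃ C θ : ℝ, 0 < C ∧ 0 < θ ∧ θ < 1 ∧
    ∀ (x y : Omega d) (N : ℕ), (∀ j : ℤ, |j| ≤ (N : ℤ) → x j = y j) →
      |U x - U y| ≤ C * θ ^ N

/-- `U` depends on only finitely many coordinates. -/
def FiniteRange (d : ℕ) (U : Omega d → ℝ) : Prop :=
  ∃ s : Finset ℤ, ∀ x y : Omega d, (∀ j ∈ s, x j = y j) → U x = U y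

/-- `V(x,y) = ∑_{k ∈ ℤ} (U(τ^k x) - U(τ^k y))`. -/
def Vfun (d : ℕ) (U : Omega d → ℝ) (x y : Omega d) : ℝ :=
  ∑' k : ℤ, (U (tauZ d k x) - U (tauZ d k y))

/-- The cylinder `{z : z_j = a_j for -n ≤ j ≤ m}`. -/
def cyl (d : ℕ) (n m : ℕ) (a : ℤ → Fin d) : Set (Omega d) :=
  {z | ∀ j : ℤ, -(n : ℤ) ≤ j → j ≤ (m : ℤ) → z j = a j}

/-- The conjugating homeomorphism with window `-n ≤ j ≤ m` and target word `b`: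
it replaces the coordinates in the window by those of `b` and keeps the rest. -/
def conjMap (d : ℕ) (n m : ℕ) (b : ℤ → Fin d) (z : Omega d) : Omega d :=
  fun j => if -(n : ℤ) ≤ j ∧ j ≤ (m : ℤ) then b j else z j

/-- `α` is a C*-Gibbs measure for `U` (at inverse temperature `β = 1`):
for every symmetric conjugating homeomorphism `(O, φ)` and every continuous
`f : Ω → ℂ`, `∫_O e^{-V(z, φ z)} f(φ z) dα = ∫_{φ(O)} f dα`. -/
def CStarGibbs (d : ℕ) (U : Omega d → ℝ) (α : Measure (Omega d)) : Prop :=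
  ∀ n : ℕ, 1 ≤ n → ∀ (a b : ℤ → Fin d) (f : Omega d → ℂ), Continuous f →
    ∫ z in cyl d n n a,
        (Real.exp (-(Vfun d U z (conjMap d n n b z))) : ℂ) * f (conjMap d n n b z) ∂α
      = ∫ z in cyl d n n b, f z ∂α

/-- `α` is a quasi-C*-Gibbs measure for `U`: there are constants `d₁, d₂ > 0`
such that for every conjugating homeomorphism `(O, φ)` and every nonnegative
continuous `f : Ω → ℝ`,
`d₁ ∫_O e^{-V(z,φz)} f(φ z) dα ≤ ∫_{φ(O)} f dα ≤ d₂ ∫_O e^{-V(z,φz)} f(φ z) dα`. -/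
def QuasiCStarGibbs (d : ℕ) (U : Omega d → ℝ) (α : Measure (Omega d)) : Prop :=
  ∃ d₁ d₂ : ℝ, 0 < d₁ ∧ 0 < d₂ ∧
    ∀ (n m : ℕ), 1 ≤ n → 1 ≤ m → ∀ (a b : ℤ → Fin d) (f : Omega d → ℝ),
      Continuous f → (∀ z, 0 ≤ f z) →
      (d₁ * ∫ z in cyl d n m a,
          Real.exp (-(Vfun d U z (conjMap d n m b z))) * f (conjMap d n m b z) ∂α
        ≤ ∫ z in cyl d n m b, f z ∂α) ∧
      (∫ z in cyl d n m b, f z ∂α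
        ≤ d₂ * ∫ z in cyl d n m a,
            Real.exp (-(Vfun d U z (conjMap d n m b z))) * f (conjMap d n m b z) ∂α)

/-- The future cylinder `{z : z_k = a_k for 1 ≤ k ≤ s}`. -/
def futureCyl (d : ℕ) (s : ℕ) (a : ℕ → Fin d) : Set (Omega d) :=
  {z | ∀ k : ℕ, 1 ≤ k → k ≤ s → z (k : ℤ) = a k}

/-- The Birkhoff sum `∑_{k=0}^{s-1} U(τ^k x)`. -/
def birkhoff (d : ℕ) (U : Omega d → ℝ) (s : ℕ) (x : Omega d) : ℝ :=
  ∑ k ∈ Finset.range s, U (tauZ d (k : ℤ) x)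

/-- `ρ` is the equilibrium (Gibbs) probability for `U`: it is `τ`-invariant and
satisfies Bowen's inequalities. -/
def IsEquilibrium (d : ℕ) (U : Omega d → ℝ) (ρ : Measure (Omega d)) : Prop :=
  Measure.map (tau d) ρ = ρ ∧
  ∃ C₁ C₂ P : ℝ, 0 < C₁ ∧ 0 < C₂ ∧
    ∀ s : ℕ, 1 ≤ s → ∀ (a : ℕ → Fin d) (x : Omega d),
      (∀ k : ℕ, 1 ≤ k → k ≤ s → x (k : ℤ) = a k) →
      C₁ ≤ (ρ (futureCyl d s a)).toReal * Real.exp (P * s - birkhoff d U s x) ∧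
      (ρ (futureCyl d s a)).toReal * Real.exp (P * s - birkhoff d U s x) ≤ C₂

/-- The point whose coordinates `1, 2, 3, …` are `j, x₁, x₂, …`. -/
def prepend (d : ℕ) (j : Fin d) (x : Omega d) : Omega d :=
  fun k => if k = 1 then j else x (k - 1)

/-- A potential depending on the coordinates `x₁, …, x_r` is normalized if
`∑_{j=1}^d exp(f(j, x₁, …, x_{r-1})) = 1` for all choices of `x₁, …, x_{r-1}`. -/
def Normalized (d : ℕ) (U : Omega d → ℝ) : Prop :=
  ∀ x : Omega d, ∑ j : Fin d, Real.exp (U (prepend d j x)) = 1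

lemma continuous_of_holderPotential {d : ℕ} {U : Omega d → ℝ} (hU : HolderPotential d U) :
    Continuous U := by
  obtain ⟨C, θ, hC, hθ, hθ1, h⟩ := hU
  rw [continuous_iff_continuousAt]
  intro x
  rw [ContinuousAt, Metric.tendsto_nhds]
  intro ε hε
  have hlim : Tendsto (fun N : ℕ => C * θ ^ N) atTop (nhds 0) := by
    simpa using (tendsto_pow_atTop_nhds_zero_of_lt_one hθ.le hθ1).const_mul C
  obtain ⟨N, hN⟩ := (hlim.eventually_lt_const hε).exists
  have hev : ∀ᶠ y in nhds x, ∀ j ∈ Finset.Icc (-(N : ℤ)) N, y j = x j := by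
    rw [Filter.eventually_all_finset]
    intro j _
    exact (continuous_apply j).continuousAt.eventually_mem
      ((isOpen_discrete {x j}).mem_nhds rfl)
  filter_upwards [hev] with y hy
  refine lt_of_le_of_lt ?_ hN
  rw [Real.dist_eq]
  exact h y x N fun j hj => hy j (Finset.mem_Icc.2 (abs_le.1 hj))

lemma continuous_tauZ (d : ℕ) (k : ℤ) : Continuous (tauZ d k) :=
  continuous_pi fun j => continuous_apply (j + k)

lemma continuous_conjMap (d n m : ℕ) (b : ℤ → Fin d) : Continuous (conjMap d n m b) := by
  refine continuous_pi fun j => ?_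
  unfold conjMap
  split_ifs
  · exact continuous_const
  · exact continuous_apply j

lemma summable_pow_natAbs_sub {θ : ℝ} (hθ : 0 < θ) (hθ1 : θ < 1) (M : ℕ) :
    Summable fun k : ℤ => θ ^ (k.natAbs - M) := by
  have h : Summable fun n : ℕ => θ ^ (n - M) := by
    rw [← summable_nat_add_iff M]
    simpa using summable_geometric_of_lt_one hθ.le hθ1
  exact Summable.of_nat_of_neg (by simpa using h) (by simpa using h)

lemma continuous_Vfun_conjMap {d : ℕ} {U : Omega d → ℝ} (hU : HolderPotential d U) (n m : ℕ)
    (b : ℤ → Fin d) : Continuous fun z => Vfun d U z (conjMap d n m b z) := by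
  have hUc := continuous_of_holderPotential hU
  obtain ⟨C, θ, hC, hθ, hθ1, h⟩ := hU
  obtain ⟨B, hB⟩ := isCompact_univ.exists_bound_of_continuousOn hUc.continuousOn
  refine continuous_tsum (u := fun k : ℤ => (C + 2 * |B|) * θ ^ (k.natAbs - (n + m + 1)))
    (fun k => (hUc.comp (continuous_tauZ d k)).sub
      (hUc.comp ((continuous_tauZ d k).comp (continuous_conjMap d n m b))))
    ((summable_pow_natAbs_sub hθ hθ1 _).mul_left _) fun k z => ?_
  rw [Real.norm_eq_abs]
  rcases le_or_gt (n + m + 1) k.natAbs with hk | hk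
  · refine (h _ _ (k.natAbs - (n + m + 1)) fun j hj => ?_).trans
      (mul_le_mul_of_nonneg_right (by linarith [abs_nonneg B]) (by positivity))
    have hout : ¬ (-(n : ℤ) ≤ j + k ∧ j + k ≤ (m : ℤ)) := by grind
    simp only [tauZ, conjMap, if_neg hout]
  · have h1 := hB (tauZ d k z) trivial
    have h2 := hB (tauZ d k (conjMap d n m b z)) trivial
    rw [Real.norm_eq_abs] at h1 h2
    rw [Nat.sub_eq_zero_of_le hk.le, pow_zero, mul_one]
    have h3 := abs_sub (U (tauZ d k z)) (U (tauZ d k (conjMap d n m b z)))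
    linarith [le_abs_self B]

lemma measurableSet_cyl (d n m : ℕ) (a : ℤ → Fin d) : MeasurableSet (cyl d n m a) := by
  simp only [cyl, Set.ofPred_forall]
  exact MeasurableSet.iInter fun j => MeasurableSet.iInter fun _ => MeasurableSet.iInter fun _ =>
    measurableSet_eq_fun (measurable_pi_apply j) measurable_const

/-- The coordinates of the window `[-N, N]` that lie outside `[-n, m]`. -/
def windowGap (n m N : ℕ) : Finset ℤ :=
  Finset.Icc (-(N : ℤ)) N \ Finset.Icc (-(n : ℤ)) m

/-- The word `a` with the letters on `windowGap n m N` replaced by those of `w`. -/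
def fillGap {d : ℕ} (n m N : ℕ) (a : ℤ → Fin d) (w : windowGap n m N → Fin d) : ℤ → Fin d :=
  fun j => if h : j ∈ windowGap n m N then w ⟨j, h⟩ else a j

lemma mem_windowGap {n m N : ℕ} {j : ℤ} : j ∈ windowGap n m N ↔
    (-(N : ℤ) ≤ j ∧ j ≤ N) ∧ ¬ (-(n : ℤ) ≤ j ∧ j ≤ m) := by
  simp only [windowGap, Finset.mem_sdiff, Finset.mem_Icc]

lemma cyl_eq_iUnion {d n m N : ℕ} (hn : n ≤ N) (hm : m ≤ N) (a : ℤ → Fin d) :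
    cyl d n m a = ⋃ w : windowGap n m N → Fin d, cyl d N N (fillGap n m N a w) := by
  ext z
  simp only [Set.mem_iUnion]
  constructor
  · refine fun hz => ⟨fun j => z j, fun j h1 h2 => ?_⟩
    unfold fillGap
    split_ifs with h
    · rfl
    · rw [mem_windowGap] at h
      exact hz j (by tauto) (by tauto)
  · rintro ⟨w, hz⟩ j h1 h2
    have h : j ∉ windowGap n m N := by rw [mem_windowGap]; tauto
    rw [hz j (by lia) (by lia), fillGap, dif_neg h]

lemma pairwise_disjoint_cyl_fillGap {d : ℕ} (n m N : ℕ) (a : ℤ → Fin d) :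
    Pairwise (Function.onFun Disjoint
      fun w : windowGap n m N → Fin d => cyl d N N (fillGap n m N a w)) := by
  intro w w' hw
  refine Set.disjoint_left.2 fun z hz hz' => hw (funext fun ⟨j, hj⟩ => ?_)
  obtain ⟨⟨h1, h2⟩, -⟩ := mem_windowGap.1 hj
  have h := (hz j h1 h2).symm.trans (hz' j h1 h2)
  simpa only [fillGap, dif_pos hj] using h

lemma conjMap_fillGap {d n m N : ℕ} (hn : n ≤ N) (hm : m ≤ N) (a b : ℤ → Fin d)
    (w : windowGap n m N → Fin d) {z : Omega d} (hz : z ∈ cyl d N N (fillGap n m N a w)) :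
    conjMap d N N (fillGap n m N b w) z = conjMap d n m b z := by
  funext j
  by_cases hj : j ∈ windowGap n m N
  · obtain ⟨hN, hnm⟩ := mem_windowGap.1 hj
    have h := hz j hN.1 hN.2
    simp only [fillGap, dif_pos hj] at h
    simp only [conjMap, if_pos hN, if_neg hnm, fillGap, dif_pos hj, h]
  · have hiff : (-(N : ℤ) ≤ j ∧ j ≤ N) ↔ (-(n : ℤ) ≤ j ∧ j ≤ m) := by
      rw [mem_windowGap] at hj
      constructor
      · tauto
      · lia
    simp only [conjMap, hiff, fillGap, dif_neg hj]

lemma setIntegral_cyl_eq_sum {d n m N : ℕ} (hn : n ≤ N) (hm : m ≤ N) (a : ℤ → Fin d)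
    (α : Measure (Omega d)) [IsFiniteMeasure α] {g : Omega d → ℂ} (hg : Continuous g) :
    ∫ z in cyl d n m a, g z ∂α =
      ∑ w : windowGap n m N → Fin d, ∫ z in cyl d N N (fillGap n m N a w), g z ∂α := by
  have hint : Integrable g α :=
    hg.integrable_of_hasCompactSupport (HasCompactSupport.of_compactSpace g)
  rw [cyl_eq_iUnion hn hm]
  exact integral_iUnion_fintype (fun w => measurableSet_cyl _ _ _ _)
    (pairwise_disjoint_cyl_fillGap n m N a) fun w => hint.integrableOn

/-- if `α` is C*-Gibbs for a Hölder `U` (symmetric conjugating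
homeomorphisms), then the Gibbs identity holds for every, possibly
non-symmetric, conjugating homeomorphism. -/
theorem cstarGibbs_nonsymmetric (d : ℕ) (hd : 2 ≤ d) (U : Omega d → ℝ)
    (hU : HolderPotential d U) (α : Measure (Omega d)) (hα : IsProbabilityMeasure α)
    (hGibbs : CStarGibbs d U α)
    (n m : ℕ) (hn : 1 ≤ n) (hm : 1 ≤ m) (a b : ℤ → Fin d)
    (f : Omega d → ℂ) (hf : Continuous f) :
    ∫ z in cyl d n m a,
        (Real.exp (-(Vfun d U z (conjMap d n m b z))) : ℂ) * f (conjMap d n m b z) ∂α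
      = ∫ z in cyl d n m b, f z ∂α := by
  have hN : n ≤ max n m := le_max_left n m
  have hM : m ≤ max n m := le_max_right n m
  have hV := continuous_Vfun_conjMap hU n m b
  have hφ := continuous_conjMap d n m b
  rw [setIntegral_cyl_eq_sum hN hM b α hf, setIntegral_cyl_eq_sum hN hM a α (by fun_prop)]
  refine Finset.sum_congr rfl fun w _ => ?_
  rw [← hGibbs _ (hn.trans hN) (fillGap n m _ a w) (fillGap n m _ b w) f hf]
  refine setIntegral_congr_fun (measurableSet_cyl _ _ _ _) fun z hz => ?_
  simp only [conjMap_fillGap hN hM a b w hz]
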